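/- Let H, N, d, d_k ∈ ℕ, B > 0, and let W_{Q,h}, W_{K,h} ∈ ℝ^{d×d_k}, W_{V,h} ∈ ℝ^{d×d} (h = 1,…,H) satisfy ‖W_{Q,h}‖_F ≤ B, ‖W_{K,h}‖_F ≤ B, ‖W_{V,h}‖_F ≤ B. Fix discard sets 𝓜_i ⊆ {1,…,i} for each row i ∈ {1,…,N}, and let mha and mha~ be the causal and lazy-masked multi-head attentions with these weights. For Z ∈ ℝ^{N×d} with ‖Z‖_{2,∞} ≤ 1, let s = max_{i∈[N]} (1/H) Σ_{h=1}^H Σ_{j∈𝓜_i} [A_h]_{ij}, where A_h is the causal attention matrix of head h computed on Z. Then ‖mha~(Z) − mha(Z)‖_{2,∞} ≤ 2·H·B·s. -/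

import Mathlib

open scoped BigOperators
open Matrix

/-- The Euclidean (ℓ²) norm on `ℝ^d`. -/
noncomputable def l2norm {d : ℕ} (x : Fin d → ℝ) : ℝ := Real.sqrt (∑ i, x i ^ 2)

/-- The ℓ_{2,∞} norm of a matrix: the maximum ℓ² norm of its rows. -/
noncomputable def norm2inf {N d : ℕ} (X : Matrix (Fin N) (Fin d) ℝ) : ℝ :=
  ⨆ i, l2norm (X i)

/-- The Frobenius norm of a matrix. -/
noncomputable def frobNorm {m n : ℕ} (A : Matrix (Fin m) (Fin n) ℝ) : ℝ :=
  Real.sqrt (∑ i, ∑ j, A i j ^ 2)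

/-- The causal attention matrix of a single head. -/
noncomputable def causalAttn {N d dk : ℕ} (X : Matrix (Fin N) (Fin d) ℝ)
    (WQ WK : Matrix (Fin d) (Fin dk) ℝ) : Matrix (Fin N) (Fin N) ℝ :=
  Matrix.of fun i j =>
    if j ≤ i then
      Real.exp ((X * WQ * (X * WK)ᵀ) i j) /
        ∑ k ∈ Finset.univ.filter (fun k : Fin N => k ≤ i),
          Real.exp ((X * WQ * (X * WK)ᵀ) i k)
    else 0

/-- Causal multi-head attention: `mha(X) = ∑_h A_h X W_{V,h}`. -/
noncomputable def mha {N d dk H : ℕ} (X : Matrix (Fin N) (Fin d) ℝ)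
    (WQ WK : Fin H → Matrix (Fin d) (Fin dk) ℝ)
    (WV : Fin H → Matrix (Fin d) (Fin d) ℝ) : Matrix (Fin N) (Fin d) ℝ :=
  ∑ h, causalAttn X (WQ h) (WK h) * X * WV h

/-- The lazy-masked attention matrix of a single head, given discard sets `M i ⊆ {0,…,i}`:
attention of row `i` is restricted to indices `j ≤ i` with `j ∉ M i` and renormalized. -/
noncomputable def lazyAttn {N d dk : ℕ} (X : Matrix (Fin N) (Fin d) ℝ)
    (WQ WK : Matrix (Fin d) (Fin dk) ℝ) (M : Fin N → Finset (Fin N)) :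
    Matrix (Fin N) (Fin N) ℝ :=
  Matrix.of fun i j =>
    if j ≤ i ∧ j ∉ M i then
      Real.exp ((X * WQ * (X * WK)ᵀ) i j) /
        ∑ k ∈ Finset.univ.filter (fun k : Fin N => k ≤ i ∧ k ∉ M i),
          Real.exp ((X * WQ * (X * WK)ᵀ) i k)
    else 0

/-- Lazy-masked causal multi-head attention. -/
noncomputable def lazyMha {N d dk H : ℕ} (X : Matrix (Fin N) (Fin d) ℝ)
    (WQ WK : Fin H → Matrix (Fin d) (Fin dk) ℝ)
    (WV : Fin H → Matrix (Fin d) (Fin d) ℝ) (M : Fin N → Finset (Fin N)) :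
    Matrix (Fin N) (Fin d) ℝ :=
  ∑ h, lazyAttn X (WQ h) (WK h) M * X * WV h

theorem l2norm_eq_norm {d : ℕ} (x : Fin d → ℝ) : l2norm x = ‖WithLp.toLp 2 x‖ := by
  simp [l2norm, EuclideanSpace.norm_eq]

theorem l2norm_sum_le {ι : Type*} {d : ℕ} (t : Finset ι) (f : ι → Fin d → ℝ) :
    l2norm (∑ i ∈ t, f i) ≤ ∑ i ∈ t, l2norm (f i) := by
  simp only [l2norm_eq_norm, WithLp.toLp_sum]
  exact norm_sum_le _ _

theorem l2norm_smul {d : ℕ} (c : ℝ) (x : Fin d → ℝ) : l2norm (c • x) = |c| * l2norm x := by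
  simp only [l2norm_eq_norm, WithLp.toLp_smul, norm_smul, Real.norm_eq_abs]

theorem l2norm_row_le_norm2inf {N d : ℕ} (X : Matrix (Fin N) (Fin d) ℝ) (i : Fin N) :
    l2norm (X i) ≤ norm2inf X :=
  le_ciSup (f := fun i => l2norm (X i)) (Set.finite_range _).bddAbove i

/-- The Frobenius norm dominates the operator norm. -/
theorem l2norm_vecMul_le {m n : ℕ} (x : Fin m → ℝ) (W : Matrix (Fin m) (Fin n) ℝ) :
    l2norm (x ᵥ* W) ≤ l2norm x * frobNorm W := by
  unfold l2norm frobNorm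
  rw [← Real.sqrt_mul (Finset.sum_nonneg fun i _ => sq_nonneg (x i))]
  apply Real.sqrt_le_sqrt
  rw [Finset.sum_comm (f := fun i j => W i j ^ 2), Finset.mul_sum]
  exact Finset.sum_le_sum fun j _ =>
    Finset.sum_mul_sq_le_sq_mul_sq Finset.univ x fun i => W i j

/-- A row of `A * Z * W` is bounded by the `ℓ¹` norm of the row of `A` when the rows of `Z`
lie in the unit ball. -/
theorem l2norm_mul_mul_row_le {N d e : ℕ} {B : ℝ} (A : Matrix (Fin N) (Fin N) ℝ)
    (Z : Matrix (Fin N) (Fin d) ℝ) (hZ : norm2inf Z ≤ 1)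
    (W : Matrix (Fin d) (Fin e) ℝ) (hW : frobNorm W ≤ B) (i : Fin N) :
    l2norm ((A * Z * W) i) ≤ B * ∑ j, |A i j| := by
  have hrow : (A * Z * W) i = ∑ j, A i j • (Z j ᵥ* W) := by
    ext k
    rw [Matrix.mul_assoc]
    simp only [Matrix.mul_apply, Finset.sum_apply, Pi.smul_apply, smul_eq_mul,
      Matrix.vecMul, dotProduct]
  rw [hrow, Finset.mul_sum]
  refine (l2norm_sum_le _ _).trans (Finset.sum_le_sum fun j _ => ?_)
  rw [l2norm_smul, mul_comm B]
  refine mul_le_mul_of_nonneg_left ((l2norm_vecMul_le _ _).trans ?_) (abs_nonneg _)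
  calc l2norm (Z j) * frobNorm W ≤ 1 * frobNorm W :=
        mul_le_mul_of_nonneg_right ((l2norm_row_le_norm2inf Z j).trans hZ) (Real.sqrt_nonneg _)
    _ ≤ B := by rwa [one_mul]

/-- Restricting a normalized weight vector to `t \ m` and renormalizing changes it in `ℓ¹`
by at most twice the discarded mass. -/
theorem sum_abs_renormalize_sub_le {ι : Type*} [DecidableEq ι] (t m : Finset ι) (hm : m ⊆ t)
    (e : ι → ℝ) (he : ∀ j, 0 < e j) :
    ∑ j ∈ t, |(if j ∈ m then 0 else e j / ∑ k ∈ t \ m, e k) - e j / ∑ k ∈ t, e k| ≤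
      2 * ∑ j ∈ m, e j / ∑ k ∈ t, e k := by
  have hsum := Finset.sum_sdiff hm (f := e)
  set T := ∑ k ∈ t \ m, e k with hT
  set S := ∑ k ∈ t, e k
  have hT0 : 0 ≤ T := Finset.sum_nonneg fun j _ => (he j).le
  have hD0 : 0 ≤ ∑ j ∈ m, e j := Finset.sum_nonneg fun j _ => (he j).le
  have hS0 : 0 ≤ S := by linarith
  rw [← Finset.sum_sdiff hm, two_mul]
  refine add_le_add ?_ (le_of_eq ?_)
  · have hkept : ∀ j ∈ t \ m,
        |(if j ∈ m then 0 else e j / T) - e j / S| = e j * (1 / T - 1 / S) := by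
      intro j hj
      have hTpos : 0 < T := Finset.sum_pos (fun j _ => he j) ⟨j, hj⟩
      have hle : 1 / S ≤ 1 / T := one_div_le_one_div_of_le hTpos (by linarith)
      rw [if_neg (Finset.mem_sdiff.1 hj).2, abs_of_nonneg]
      · ring
      · have := mul_nonneg (he j).le (sub_nonneg.2 hle)
        linarith [show e j * (1 / T - 1 / S) = e j / T - e j / S by ring]
    rw [Finset.sum_congr rfl hkept, ← Finset.sum_mul, ← hT, ← Finset.sum_div]
    rcases hT0.eq_or_lt with h0 | hpos
    · rw [← h0, zero_mul]
      positivity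
    · have hSpos : 0 < S := by linarith
      apply le_of_eq
      field_simp
      linarith
  · refine Finset.sum_congr rfl fun j hj => ?_
    rw [if_pos hj, zero_sub, abs_neg, abs_of_nonneg (div_nonneg (he j).le hS0)]

theorem sum_abs_lazyAttn_sub_causalAttn_le {N d dk : ℕ} (X : Matrix (Fin N) (Fin d) ℝ)
    (WQ WK : Matrix (Fin d) (Fin dk) ℝ) (M : Fin N → Finset (Fin N)) (i : Fin N)
    (hM : ∀ j ∈ M i, j ≤ i) :
    ∑ j, |(lazyAttn X WQ WK M - causalAttn X WQ WK) i j| ≤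
      2 * ∑ j ∈ M i, causalAttn X WQ WK i j := by
  have key := sum_abs_renormalize_sub_le (Finset.univ.filter (· ≤ i)) (M i)
    (fun j hj => by simpa using hM j hj) (fun j => Real.exp ((X * WQ * (X * WK)ᵀ) i j))
    fun j => Real.exp_pos _
  have hkept : Finset.univ.filter (fun k : Fin N => k ≤ i ∧ k ∉ M i) =
      Finset.univ.filter (· ≤ i) \ M i := by
    ext k
    simp
  convert key using 1
  · rw [Finset.sum_filter]
    refine Finset.sum_congr rfl fun j _ => ?_
    by_cases hj : j ≤ i <;> by_cases hjM : j ∈ M i <;>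
      simp [lazyAttn, causalAttn, hj, hjM, hkept]
  · congr 1
    refine Finset.sum_congr rfl fun j hj => ?_
    simp [causalAttn, hM j hj]

/-- `‖mha~(Z) − mha(Z)‖_{2,∞} ≤ 2 H B s`, where `s` is the maximal average discarded
attention score. -/
theorem lazy_mha_error {H N d dk : ℕ} (B : ℝ) (hB : 0 < B)
    (WQ WK : Fin H → Matrix (Fin d) (Fin dk) ℝ)
    (WV : Fin H → Matrix (Fin d) (Fin d) ℝ)
    (hWQ : ∀ h, frobNorm (WQ h) ≤ B)
    (hWK : ∀ h, frobNorm (WK h) ≤ B)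
    (hWV : ∀ h, frobNorm (WV h) ≤ B)
    (M : Fin N → Finset (Fin N)) (hM : ∀ i : Fin N, ∀ j ∈ M i, j ≤ i)
    (Z : Matrix (Fin N) (Fin d) ℝ) (hZ : norm2inf Z ≤ 1)
    (s : ℝ)
    (hs : s = ⨆ i : Fin N,
      (1 / (H : ℝ)) * ∑ h, ∑ j ∈ M i, causalAttn Z (WQ h) (WK h) i j) :
    norm2inf (lazyMha Z WQ WK WV M - mha Z WQ WK WV) ≤ 2 * H * B * s := by
  have hrow : ∀ i : Fin N, l2norm ((lazyMha Z WQ WK WV M - mha Z WQ WK WV) i) ≤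
      2 * H * B * s := by
    intro i
    have hsplit : (lazyMha Z WQ WK WV M - mha Z WQ WK WV) i =
        ∑ h, ((lazyAttn Z (WQ h) (WK h) M - causalAttn Z (WQ h) (WK h)) * Z * WV h) i := by
      ext k
      simp [lazyMha, mha, Matrix.sub_mul, Matrix.sum_apply]
    have hsi : (1 / (H : ℝ)) * ∑ h, ∑ j ∈ M i, causalAttn Z (WQ h) (WK h) i j ≤ s := by
      rw [hs]
      exact le_ciSup (f := fun i : Fin N =>
        (1 / (H : ℝ)) * ∑ h, ∑ j ∈ M i, causalAttn Z (WQ h) (WK h) i j)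
        (Set.finite_range _).bddAbove i
    have hmass : ∑ h, ∑ j ∈ M i, causalAttn Z (WQ h) (WK h) i j ≤ H * s := by
      rcases Nat.eq_zero_or_pos H with rfl | hH
      · simp
      · have hH' : (0 : ℝ) < H := Nat.cast_pos.2 hH
        rwa [one_div, inv_mul_le_iff₀ hH'] at hsi
    rw [hsplit]
    calc _ ≤ ∑ h, B * (2 * ∑ j ∈ M i, causalAttn Z (WQ h) (WK h) i j) :=
          (l2norm_sum_le _ _).trans (Finset.sum_le_sum fun h _ =>
            (l2norm_mul_mul_row_le _ Z hZ _ (hWV h) i).trans (mul_le_mul_of_nonneg_left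
              (sum_abs_lazyAttn_sub_causalAttn_le Z (WQ h) (WK h) M i (hM i)) hB.le))
      _ = 2 * B * ∑ h, ∑ j ∈ M i, causalAttn Z (WQ h) (WK h) i j := by
          rw [Finset.mul_sum]
          exact Finset.sum_congr rfl fun h _ => by ring
      _ ≤ 2 * B * (H * s) := mul_le_mul_of_nonneg_left hmass (by positivity)
      _ = 2 * H * B * s := by ring
  rcases isEmpty_or_nonempty (Fin N) with hN | hN
  · simp [norm2inf, hs, Real.iSup_of_isEmpty]
  · exact ciSup_le hrow
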